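/- arXiv:2305.00661 — 2 statements merged into one kernel-verified Lean document; each statement's English description precedes it below -/
import Mathlib

section
/- Existence of a minimizer for the variational functional (proof of Lemma 3.1, Appendix A). Let n ≥ 1, let Ω ⊂ ℝⁿ be a bounded domain, s ∈ (0,1), p > 1, q > 0, h > 0, and let v ∈ X = W^{s,p}_0(Ω) ∩ L^{q+1}(Ω). Define, for w ∈ X, 𝓕(w) := (1/h)∫_Ω ( (1/(q+1))|w|^{q+1} − |v|^{q−1}v·w ) dx + (1/(2p)) [w]_{W^{s,p}(ℝⁿ)}^p. Then inf_{w∈X} 𝓕(w) > −∞ and there exists u ∈ X with 𝓕(u) = inf_{w∈X} 𝓕(w). -/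
open MeasureTheory ENNReal Real Filter Set

noncomputable section

/-- `ℝⁿ` with the Euclidean structure. -/
abbrev Rn (n : ℕ) : Type := EuclideanSpace ℝ (Fin n)

/-- A bounded domain in `ℝⁿ`: a nonempty connected open bounded set. -/
def IsBoundedDomain {n : ℕ} (Ω : Set (Rn n)) : Prop :=
  IsOpen Ω ∧ IsConnected Ω ∧ Bornology.IsBounded Ω

/-- The Gagliardo `W^{s,p}` energy `∬ |v x − v y|^p / |x−y|^{n+sp} dx dy`,
as an extended real number. -/
def gagliardoE (n : ℕ) (s p : ℝ) (v : Rn n → ℝ) : ℝ≥0∞ :=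
  ∫⁻ x : Rn n, ∫⁻ y : Rn n, ENNReal.ofReal (|v x - v y| ^ p / dist x y ^ ((n : ℝ) + s * p))

/-- The Gagliardo seminorm `[v]_{W^{s,p}(ℝⁿ)}` as a real number
(meaningful when the Gagliardo energy is finite). -/
def gagliardoSemi (n : ℕ) (s p : ℝ) (v : Rn n → ℝ) : ℝ :=
  (gagliardoE n s p v).toReal ^ (1 / p)

/-- The class `X = W^{s,p}_0(Ω) ∩ L^{q+1}(Ω)`: measurable functions vanishing a.e.
outside `Ω`, belonging to `L^p(ℝⁿ)`, with finite Gagliardo energy and finite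
`L^{q+1}(Ω)` norm. -/
def MemX (n : ℕ) (Ω : Set (Rn n)) (s p q : ℝ) (u : Rn n → ℝ) : Prop :=
  Measurable u ∧ (∀ᵐ x : Rn n, x ∉ Ω → u x = 0) ∧
    (∫⁻ x : Rn n, ENNReal.ofReal (|u x| ^ p)) < ⊤ ∧
    gagliardoE n s p u < ⊤ ∧
    (∫⁻ x in Ω, ENNReal.ofReal (|u x| ^ (q + 1))) < ⊤

/-- The variational functional `F` of Appendix A. -/
def Ffun (n : ℕ) (Ω : Set (Rn n)) (s p q h : ℝ) (v w : Rn n → ℝ) : ℝ :=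
  (1 / h) * (∫ x in Ω, ((1 / (q + 1)) * |w x| ^ (q + 1) - |v x| ^ (q - 1) * v x * w x)) +
    (1 / (2 * p)) * (gagliardoE n s p w).toReal

open scoped Topology

/-- Midpoint convexity of `t ↦ |t| ^ r`. -/
theorem abs_midpoint_rpow_le {r : ℝ} (hr : 1 ≤ r) (a b : ℝ) :
    |(a + b) / 2| ^ r ≤ (|a| ^ r + |b| ^ r) / 2 := by
  have hconv := (convexOn_rpow hr).2 (abs_nonneg a) (abs_nonneg b)
    (by norm_num : (0 : ℝ) ≤ 1 / 2) (by norm_num : (0 : ℝ) ≤ 1 / 2) (by norm_num)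
  simp only [smul_eq_mul] at hconv
  have habs : |(a + b) / 2| ≤ 1 / 2 * |a| + 1 / 2 * |b| := by
    rw [abs_div, abs_two]
    linarith [abs_add_le a b]
  have := rpow_le_rpow (abs_nonneg _) habs (by linarith : 0 ≤ r)
  linarith

/-- Strict midpoint convexity of `t ↦ |t| ^ r`. -/
theorem abs_midpoint_rpow_lt {r : ℝ} (hr : 1 < r) {a b : ℝ} (hab : a ≠ b) :
    |(a + b) / 2| ^ r < (|a| ^ r + |b| ^ r) / 2 := by
  by_cases h : |a| = |b|
  · rcases abs_eq_abs.1 h with h' | h'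
    · exact absurd h' hab
    · have hb : b ≠ 0 := by
        rintro rfl
        simp_all
      have := rpow_pos_of_pos (abs_pos.2 hb) r
      rw [h, h', neg_add_cancel, zero_div, abs_zero, zero_rpow (by linarith)]
      linarith
  · have hconv := (strictConvexOn_rpow hr).2 (abs_nonneg a) (abs_nonneg b) h
      (by norm_num : (0 : ℝ) < 1 / 2) (by norm_num : (0 : ℝ) < 1 / 2) (by norm_num)
    simp only [smul_eq_mul] at hconv
    have habs : |(a + b) / 2| ≤ 1 / 2 * |a| + 1 / 2 * |b| := by
      rw [abs_div, abs_two]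
      linarith [abs_add_le a b]
    have := rpow_le_rpow (abs_nonneg _) habs (by linarith : 0 ≤ r)
    linarith

/-- For `r > 1`, a small multiple of `|t| ^ r` dominates `|t|` once `|t|` is large. -/
theorem exists_le_mul_rpow {r : ℝ} (hr : 1 < r) {ε : ℝ} (hε : 0 < ε) :
    ∃ M > 0, ∀ t, M ≤ t → t ≤ ε * t ^ r := by
  have htend := (tendsto_rpow_atTop (by linarith : 0 < r - 1)).eventually_ge_atTop (1 / ε)
  obtain ⟨M, hM⟩ := eventually_atTop.1 htend
  refine ⟨max M 1, by positivity, fun t ht => ?_⟩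
  have ht0 : 0 < t := lt_of_lt_of_le one_pos ((le_max_right _ _).trans ht)
  have h1 := hM t ((le_max_left _ _).trans ht)
  rw [div_le_iff₀ hε] at h1
  calc t = t * 1 := (mul_one t).symm
    _ ≤ t * (t ^ (r - 1) * ε) := by gcongr
    _ = ε * t ^ r := by
      rw [rpow_sub_one ht0.ne']
      field_simp

/-- The convexity deficit of `|t| ^ r` controls the distance `|a - b|` up to a small multiple
of `1 + |a| ^ r + |b| ^ r`. -/
theorem exists_abs_sub_le_deficit {r : ℝ} (hr : 1 < r) {ε : ℝ} (hε : 0 < ε) :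
    ∃ C ≥ 0, ∀ a b : ℝ, |a - b| ≤ ε * (1 + |a| ^ r + |b| ^ r) +
      C * ((|a| ^ r + |b| ^ r) / 2 - |(a + b) / 2| ^ r) := by
  obtain ⟨M, hM0, hM⟩ := exists_le_mul_rpow hr (half_pos hε)
  let D : ℝ × ℝ → ℝ := fun z => (|z.1| ^ r + |z.2| ^ r) / 2 - |(z.1 + z.2) / 2| ^ r
  let S : Set (ℝ × ℝ) := (Icc (-M) M ×ˢ Icc (-M) M) ∩ {z | ε ≤ |z.1 - z.2|}
  have hcont : Continuous D := by
    have hr0 : 0 ≤ r := by linarith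
    have hpow : Continuous fun t : ℝ => |t| ^ r := continuous_abs.rpow_const fun _ => Or.inr hr0
    exact (((hpow.comp continuous_fst).add (hpow.comp continuous_snd)).div_const 2).sub
      (hpow.comp ((continuous_fst.add continuous_snd).div_const 2))
  have hS : IsCompact S :=
    (isCompact_Icc.prod isCompact_Icc).inter_right
      (isClosed_le continuous_const (continuous_fst.sub continuous_snd).abs)
  have hDpos : ∀ z ∈ S, 0 < D z := by
    rintro ⟨a, b⟩ ⟨-, hz⟩
    have hab : a ≠ b := by
      rintro rfl
      simp only [mem_ofPred_eq, sub_self, abs_zero] at hz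
      linarith
    exact sub_pos.2 (abs_midpoint_rpow_lt hr hab)
  obtain ⟨δ, hδ, hDδ⟩ := hS.exists_forall_le' hcont.continuousOn hDpos
  refine ⟨2 * M / δ, by positivity, fun a b => ?_⟩
  have ha := rpow_nonneg (abs_nonneg a) r
  have hb := rpow_nonneg (abs_nonneg b) r
  have hD0 : 0 ≤ (|a| ^ r + |b| ^ r) / 2 - |(a + b) / 2| ^ r :=
    sub_nonneg.2 (abs_midpoint_rpow_le hr.le a b)
  have hCD : 0 ≤ 2 * M / δ * ((|a| ^ r + |b| ^ r) / 2 - |(a + b) / 2| ^ r) := by positivity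
  have hsub := abs_sub a b
  by_cases hclose : |a - b| < ε
  · nlinarith [mul_nonneg hε.le ha, mul_nonneg hε.le hb]
  by_cases hbd : |a| ≤ M ∧ |b| ≤ M
  · have := hDδ (a, b) ⟨⟨abs_le.1 hbd.1, abs_le.1 hbd.2⟩, not_lt.1 hclose⟩
    have h2 : 2 * M ≤ 2 * M / δ * ((|a| ^ r + |b| ^ r) / 2 - |(a + b) / 2| ^ r) := by
      calc 2 * M = 2 * M / δ * δ := by field_simp
        _ ≤ _ := by gcongr
    have : 0 ≤ ε * (1 + |a| ^ r + |b| ^ r) := by positivity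
    linarith [hbd.1, hbd.2]
  · have key : max |a| |b| ≤ ε / 2 * (max |a| |b|) ^ r := by
      apply hM
      by_contra! hlt
      exact hbd ⟨((le_max_left _ _).trans_lt hlt).le, ((le_max_right _ _).trans_lt hlt).le⟩
    have hmax : (max |a| |b|) ^ r ≤ |a| ^ r + |b| ^ r := by
      rcases max_choice |a| |b| with h | h <;> rw [h] <;> linarith
    have h3 : ε / 2 * (max |a| |b|) ^ r ≤ ε / 2 * (|a| ^ r + |b| ^ r) := by gcongr
    nlinarith [le_max_left |a| |b|, le_max_right |a| |b|]

/-- A Young-type inequality, with a small constant in front of `|t| ^ (q + 1)`. -/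
theorem rpow_mul_abs_le {q : ℝ} (hq : 0 < q) (a t : ℝ) :
    |a| ^ q * |t| ≤ 1 / (2 * (q + 1)) * |t| ^ (q + 1) +
      (2 * (q + 1)) ^ (1 / q) * |a| ^ (q + 1) := by
  have hc : 0 < 2 * (q + 1) := by linarith
  have hK : 0 < (2 * (q + 1)) ^ (1 / q) := rpow_pos_of_pos hc _
  have hpow : ∀ x : ℝ, |x| ^ (q + 1) = |x| ^ q * |x| := fun x => by
    rw [rpow_add_of_nonneg (abs_nonneg x) hq.le zero_le_one, Real.rpow_one]
  have ha := rpow_nonneg (abs_nonneg a) q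
  have ht := rpow_nonneg (abs_nonneg t) q
  rw [hpow, hpow]
  rcases le_total |t| ((2 * (q + 1)) ^ (1 / q) * |a|) with h | h
  · have h1 : |a| ^ q * |t| ≤ |a| ^ q * ((2 * (q + 1)) ^ (1 / q) * |a|) := by gcongr
    have h2 : 0 ≤ 1 / (2 * (q + 1)) * (|t| ^ q * |t|) := by positivity
    linarith
  · have h1 := rpow_le_rpow (by positivity) h hq.le
    rw [mul_rpow hK.le (abs_nonneg a), ← rpow_mul hc.le, one_div_mul_cancel hq.ne', Real.rpow_one] at h1
    have h2 : |a| ^ q ≤ 1 / (2 * (q + 1)) * |t| ^ q := by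
      rw [one_div, ← div_eq_inv_mul, le_div_iff₀ hc]
      linarith
    have h3 : |a| ^ q * |t| ≤ 1 / (2 * (q + 1)) * |t| ^ q * |t| := by gcongr
    have h4 : 0 ≤ (2 * (q + 1)) ^ (1 / q) * (|a| ^ q * |a|) := by positivity
    linarith

theorem integrable_of_integrable_abs_rpow {α : Type*} [MeasurableSpace α] {μ : Measure α}
    [IsFiniteMeasure μ] {r : ℝ} (hr : 1 ≤ r) {w : α → ℝ} (hw : Measurable w)
    (hwr : Integrable (fun x => |w x| ^ r) μ) : Integrable w μ := by
  refine ((integrable_const (1 : ℝ)).add hwr).mono' hw.aestronglyMeasurable (ae_of_all _ fun x => ?_)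
  have h0 := rpow_nonneg (abs_nonneg (w x)) r
  rw [norm_eq_abs, Pi.add_apply]
  rcases le_total |w x| 1 with h | h
  · linarith
  · linarith [self_le_rpow_of_one_le h hr]

theorem measurable_abs_rpow {α : Type*} [MeasurableSpace α] {w : α → ℝ} (hw : Measurable w)
    (r : ℝ) : Measurable fun x => |w x| ^ r :=
  hw.abs.pow_const r

theorem integrable_abs_midpoint_rpow {α : Type*} [MeasurableSpace α] {μ : Measure α}
    {r : ℝ} (hr : 1 ≤ r) {f g : α → ℝ} (hf : Measurable f) (hg : Measurable g)
    (hfr : Integrable (fun x => |f x| ^ r) μ) (hgr : Integrable (fun x => |g x| ^ r) μ) :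
    Integrable (fun x => |(f x + g x) / 2| ^ r) μ := by
  refine ((hfr.add hgr).div_const 2).mono'
    (measurable_abs_rpow ((hf.add hg).div_const 2) r).aestronglyMeasurable (ae_of_all _ fun x => ?_)
  rw [norm_of_nonneg (rpow_nonneg (abs_nonneg _) r)]
  exact abs_midpoint_rpow_le hr _ _

/-- If a sequence is bounded in `L ^ r` and its convexity deficits tend to zero, then a subsequence
converges almost everywhere. -/
theorem exists_seq_tendsto_ae_of_deficit {α : Type*} [MeasurableSpace α] {μ : Measure α}
    [IsFiniteMeasure μ] {r : ℝ} (hr : 1 < r) {w : ℕ → α → ℝ} (hw : ∀ k, Measurable (w k))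
    (hwr : ∀ k, Integrable (fun x => |w k x| ^ r) μ) {B : ℝ}
    (hB : ∀ k, ∫ x, |w k x| ^ r ∂μ ≤ B) {η : ℕ → ℝ} (hη : Tendsto η atTop (𝓝 0))
    (hdef : ∀ j k, ∫ x, ((|w j x| ^ r + |w k x| ^ r) / 2 - |(w j x + w k x) / 2| ^ r) ∂μ
      ≤ η j + η k) :
    ∃ u : α → ℝ, Measurable u ∧ ∃ ns : ℕ → ℕ, StrictMono ns ∧
      ∀ᵐ x ∂μ, Tendsto (fun i => w (ns i) x) atTop (𝓝 (u x)) := by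
  have hint : ∀ k, Integrable (w k) μ := fun k =>
    integrable_of_integrable_abs_rpow hr.le (hw k) (hwr k)
  have hB0 : 0 ≤ B := (integral_nonneg fun x => rpow_nonneg (abs_nonneg _) r).trans (hB 0)
  have hcauchy : CauchySeq fun k => (hint k).toL1 (w k) := by
    rw [Metric.cauchySeq_iff]
    intro ε hε
    set m := μ.real univ
    have hm0 : 0 ≤ m := measureReal_nonneg
    obtain ⟨C, hC0, hC⟩ := exists_abs_sub_le_deficit hr
      (show 0 < ε / (2 * (m + 2 * B + 1)) by positivity)
    obtain ⟨N, hN⟩ := eventually_atTop.1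
      (hη.eventually (gt_mem_nhds (show 0 < ε / (4 * (C + 1)) by positivity)))
    refine ⟨N, fun j hj k hk => ?_⟩
    have hdist : dist ((hint j).toL1 (w j)) ((hint k).toL1 (w k)) = ∫ x, |w j x - w k x| ∂μ := by
      rw [dist_edist, Integrable.edist_toL1_toL1]
      simp_rw [edist_dist, Real.dist_eq]
      exact (integral_eq_lintegral_of_nonneg_ae (ae_of_all _ fun x => abs_nonneg _)
        ((hint j).sub (hint k)).abs.aestronglyMeasurable).symm
    have hD : Integrable (fun x => (|w j x| ^ r + |w k x| ^ r) / 2 - |(w j x + w k x) / 2| ^ r) μ :=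
      (((hwr j).add (hwr k)).div_const 2).sub
        (integrable_abs_midpoint_rpow hr.le (hw j) (hw k) (hwr j) (hwr k))
    have hS1 : Integrable (fun x => 1 + |w j x| ^ r) μ := (integrable_const 1).add (hwr j)
    have hS : Integrable (fun x => 1 + |w j x| ^ r + |w k x| ^ r) μ := hS1.add (hwr k)
    rw [hdist]
    have hle := integral_mono ((hint j).sub (hint k)).abs
      ((hS.const_mul (ε / (2 * (m + 2 * B + 1)))).add (hD.const_mul C))
      (fun x => hC (w j x) (w k x))
    have hsum : ∫ x, (1 + |w j x| ^ r + |w k x| ^ r) ∂μ ≤ m + 2 * B := by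
      rw [integral_add hS1 (hwr k), integral_add (integrable_const 1) (hwr j)]
      simp only [integral_const, smul_eq_mul, mul_one]
      linarith [hB j, hB k]
    rw [integral_add' (hS.const_mul _) (hD.const_mul _), integral_const_mul,
      integral_const_mul] at hle
    have h1 : ε / (2 * (m + 2 * B + 1)) * ∫ x, (1 + |w j x| ^ r + |w k x| ^ r) ∂μ < ε / 2 := by
      calc _ ≤ ε / (2 * (m + 2 * B + 1)) * (m + 2 * B) := by gcongr
        _ < ε / (2 * (m + 2 * B + 1)) * (m + 2 * B + 1) :=
            mul_lt_mul_of_pos_left (by linarith) (by positivity)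
        _ = ε / 2 := by field_simp
    have h2 : C * ∫ x, ((|w j x| ^ r + |w k x| ^ r) / 2 - |(w j x + w k x) / 2| ^ r) ∂μ
        ≤ ε / 2 := by
      calc _ ≤ C * (ε / (4 * (C + 1)) + ε / (4 * (C + 1))) := by
            gcongr
            exact (hdef j k).trans (add_le_add (hN j hj).le (hN k hk).le)
        _ ≤ (C + 1) * (ε / (4 * (C + 1)) + ε / (4 * (C + 1))) := by gcongr; linarith
        _ = ε / 2 := by field_simp; ring
    exact lt_of_le_of_lt hle (by linarith)
  obtain ⟨g, hg⟩ := cauchySeq_tendsto_of_complete hcauchy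
  obtain ⟨ns, hns, hlim⟩ := (tendstoInMeasure_of_tendsto_Lp hg).exists_seq_tendsto_ae
  refine ⟨g, (Lp.stronglyMeasurable g).measurable, ns, hns, ?_⟩
  filter_upwards [hlim, ae_all_iff.2 fun k => (hint k).coeFn_toL1] with x hx hk
  simpa only [hk] using hx

/-- Fatou's lemma along an almost everywhere convergent sequence with convergent integrals. -/
theorem lintegral_le_of_tendsto_ae {α : Type*} [MeasurableSpace α] {μ : Measure α}
    {f : ℕ → α → ℝ≥0∞} {g : α → ℝ≥0∞} {L : ℝ≥0∞} (hf : ∀ k, Measurable (f k))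
    (hfg : ∀ᵐ x ∂μ, Tendsto (fun k => f k x) atTop (𝓝 (g x)))
    (hL : Tendsto (fun k => ∫⁻ x, f k x ∂μ) atTop (𝓝 L)) : ∫⁻ x, g x ∂μ ≤ L :=
  calc ∫⁻ x, g x ∂μ = ∫⁻ x, liminf (fun k => f k x) atTop ∂μ :=
        lintegral_congr_ae (hfg.mono fun _ hx => hx.liminf_eq.symm)
    _ ≤ liminf (fun k => ∫⁻ x, f k x ∂μ) atTop := lintegral_liminf_le hf
    _ = L := hL.liminf_eq

theorem measurable_gagliardo_kernel {n : ℕ} (s p : ℝ) {v : Rn n → ℝ} (hv : Measurable v) :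
    Measurable fun z : Rn n × Rn n =>
      ENNReal.ofReal (|v z.1 - v z.2| ^ p / dist z.1 z.2 ^ ((n : ℝ) + s * p)) :=
  ((measurable_abs_rpow ((hv.comp measurable_fst).sub (hv.comp measurable_snd)) p).div
    ((measurable_fst.dist measurable_snd).pow_const _)).ennreal_ofReal

theorem measurable_gagliardo_kernel_right {n : ℕ} (s p : ℝ) {v : Rn n → ℝ} (hv : Measurable v)
    (x : Rn n) :
    Measurable fun y => ENNReal.ofReal (|v x - v y| ^ p / dist x y ^ ((n : ℝ) + s * p)) :=
  ((measurable_abs_rpow (measurable_const.sub hv) p).div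
    ((measurable_const.dist measurable_id).pow_const _)).ennreal_ofReal

theorem measurable_lintegral_gagliardo_kernel {n : ℕ} (s p : ℝ) {v : Rn n → ℝ}
    (hv : Measurable v) : Measurable fun x => ∫⁻ y : Rn n,
      ENNReal.ofReal (|v x - v y| ^ p / dist x y ^ ((n : ℝ) + s * p)) :=
  (measurable_gagliardo_kernel s p hv).lintegral_prod_right'

/-- Lower semicontinuity of the Gagliardo energy under almost everywhere convergence. -/
theorem gagliardoE_le_of_tendsto_ae {n : ℕ} {s p : ℝ} (hp : 0 ≤ p) {w : ℕ → Rn n → ℝ}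
    {u : Rn n → ℝ} (hw : ∀ k, Measurable (w k))
    (hlim : ∀ᵐ x, Tendsto (fun k => w k x) atTop (𝓝 (u x))) {L : ℝ≥0∞}
    (hL : Tendsto (fun k => gagliardoE n s p (w k)) atTop (𝓝 L)) : gagliardoE n s p u ≤ L := by
  calc gagliardoE n s p u
      ≤ ∫⁻ x : Rn n, liminf (fun k => ∫⁻ y : Rn n,
          ENNReal.ofReal (|w k x - w k y| ^ p / dist x y ^ ((n : ℝ) + s * p))) atTop := by
        refine lintegral_mono_ae (hlim.mono fun x hx => ?_)
        refine le_trans (lintegral_mono_ae (hlim.mono fun y hy => ?_))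
          (lintegral_liminf_le fun k => measurable_gagliardo_kernel_right s p (hw k) x)
        have hxy : Tendsto (fun k => |w k x - w k y| ^ p / dist x y ^ ((n : ℝ) + s * p)) atTop
            (𝓝 (|u x - u y| ^ p / dist x y ^ ((n : ℝ) + s * p))) :=
          ((hx.sub hy).abs.rpow_const (Or.inr hp)).div_const _
        exact (ENNReal.tendsto_ofReal hxy).liminf_eq.ge
    _ ≤ liminf (fun k => gagliardoE n s p (w k)) atTop :=
        lintegral_liminf_le fun k => measurable_lintegral_gagliardo_kernel s p (hw k)
    _ = L := hL.liminf_eq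

/-- Midpoint convexity of the Gagliardo energy. -/
theorem gagliardoE_midpoint_le {n : ℕ} {s p : ℝ} (hp : 1 ≤ p) {f g : Rn n → ℝ}
    (hf : Measurable f) :
    gagliardoE n s p (fun x => (f x + g x) / 2) ≤
      ENNReal.ofReal (1 / 2) * (gagliardoE n s p f + gagliardoE n s p g) := by
  unfold gagliardoE
  rw [← lintegral_add_left (measurable_lintegral_gagliardo_kernel s p hf),
    ← lintegral_const_mul' _ _ ENNReal.ofReal_ne_top]
  refine lintegral_mono fun x => ?_
  rw [← lintegral_add_left (measurable_gagliardo_kernel_right s p hf x),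
    ← lintegral_const_mul' _ _ ENNReal.ofReal_ne_top]
  refine lintegral_mono fun y => ?_
  have hd : 0 ≤ dist x y ^ ((n : ℝ) + s * p) := rpow_nonneg dist_nonneg _
  rw [← ENNReal.ofReal_add (by positivity) (by positivity), ← ENNReal.ofReal_mul (by norm_num),
    ← add_div, ← mul_div_assoc]
  refine ENNReal.ofReal_le_ofReal (div_le_div_of_nonneg_right ?_ hd)
  have := abs_midpoint_rpow_le hp (f x - f y) (g x - g y)
  rw [show (f x + g x) / 2 - (f y + g y) / 2 = (f x - f y + (g x - g y)) / 2 by ring]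
  linarith

/-- A function with finite Gagliardo energy which vanishes outside a bounded set is in `L ^ p`. -/
theorem lintegral_rpow_lt_top_of_gagliardoE {n : ℕ} (hn : 1 ≤ n) {Ω : Set (Rn n)}
    (hΩ : MeasurableSet Ω) (hbdd : Bornology.IsBounded Ω) {s p : ℝ} (hs : 0 < s) (hp : 0 < p)
    {u : Rn n → ℝ} (hu : Measurable u) (hu0 : ∀ᵐ x : Rn n, x ∉ Ω → u x = 0)
    (hE : gagliardoE n s p u < ⊤) : ∫⁻ x : Rn n, ENNReal.ofReal (|u x| ^ p) < ⊤ := by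
  have : Nonempty (Fin n) := ⟨⟨0, hn⟩⟩
  have hfin := ae_lt_top (measurable_lintegral_gagliardo_kernel s p hu) hE.ne
  have hcompl : volume Ωᶜ ≠ 0 := by
    intro h0
    have := measure_add_measure_compl (μ := (volume : Measure (Rn n))) hΩ
    rw [h0, add_zero, measure_univ_of_isAddLeftInvariant] at this
    exact hbdd.measure_lt_top.ne this
  obtain ⟨x₀, hx₀Ω, hx₀, hux₀⟩ : ∃ x₀ ∉ Ω, (∫⁻ y : Rn n, ENNReal.ofReal
      (|u x₀ - u y| ^ p / dist x₀ y ^ ((n : ℝ) + s * p))) < ⊤ ∧ u x₀ = 0 := by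
    by_contra! hcon
    refine hcompl (measure_mono_null (fun x hx => ?_) (ae_iff.1 (hfin.and hu0)))
    rintro ⟨h1, h2⟩
    exact hcon x hx h1 (h2 hx)
  obtain ⟨R, hR⟩ := hbdd.subset_closedBall x₀
  set c := (n : ℝ) + s * p
  have hc : 0 < c := by positivity
  refine lt_of_le_of_lt (lintegral_mono_ae (hu0.mono fun y hy => ?_))
    ((lintegral_const_mul' (ENNReal.ofReal (R ^ c)) _ ENNReal.ofReal_ne_top).trans_lt
      (ENNReal.mul_lt_top ENNReal.ofReal_lt_top hx₀))
  by_cases hyΩ : y ∈ Ω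
  · have hdR : dist x₀ y ≤ R := by
      rw [dist_comm]
      exact hR hyΩ
    have hd : 0 < dist x₀ y := dist_pos.2 fun h => hx₀Ω (h ▸ hyΩ)
    rw [hux₀, zero_sub, abs_neg, ← ENNReal.ofReal_mul (rpow_nonneg (hd.le.trans hdR) c)]
    refine ENNReal.ofReal_le_ofReal ?_
    have h1 : dist x₀ y ^ c ≤ R ^ c := rpow_le_rpow hd.le hdR hc.le
    have h2 : 0 < dist x₀ y ^ c := rpow_pos_of_pos hd c
    have h3 : 0 ≤ |u y| ^ p := rpow_nonneg (abs_nonneg _) p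
    rw [← mul_div_assoc, le_div_iff₀ h2, mul_comm]
    gcongr
  · simp [hy hyΩ, zero_rpow hp.ne']

theorem lintegral_abs_rpow_lt_top_iff {α : Type*} [MeasurableSpace α] {μ : Measure α} {r : ℝ}
    {w : α → ℝ} (hw : Measurable w) :
    ∫⁻ x, ENNReal.ofReal (|w x| ^ r) ∂μ < ⊤ ↔ Integrable (fun x => |w x| ^ r) μ := by
  rw [← hasFiniteIntegral_iff_ofReal (ae_of_all _ fun x => rpow_nonneg (abs_nonneg (w x)) r)]
  exact ⟨fun h => ⟨(measurable_abs_rpow hw r).aestronglyMeasurable, h⟩, fun h => h.2⟩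

theorem MemX.integrable_abs_rpow {n : ℕ} {Ω : Set (Rn n)} {s p q : ℝ} {w : Rn n → ℝ}
    (hw : MemX n Ω s p q w) : Integrable (fun x => |w x| ^ (q + 1)) (volume.restrict Ω) :=
  (lintegral_abs_rpow_lt_top_iff hw.1).1 hw.2.2.2.2

theorem memX_zero {n : ℕ} {Ω : Set (Rn n)} {s p q : ℝ} (hp : 0 < p) (hq : 0 < q) :
    MemX n Ω s p q fun _ => 0 := by
  refine ⟨measurable_const, ae_of_all _ fun _ _ => rfl, ?_, ?_, ?_⟩ <;>
    simp [gagliardoE, zero_rpow hp.ne', zero_rpow (by linarith : q + 1 ≠ 0)]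

theorem MemX.midpoint {n : ℕ} {Ω : Set (Rn n)} {s p q : ℝ} (hp : 1 ≤ p) (hq : 0 < q)
    {f g : Rn n → ℝ} (hf : MemX n Ω s p q f) (hg : MemX n Ω s p q g) :
    MemX n Ω s p q fun x => (f x + g x) / 2 := by
  have hm : Measurable fun x => (f x + g x) / 2 := (hf.1.add hg.1).div_const 2
  refine ⟨hm, ?_, ?_, ?_, ?_⟩
  · filter_upwards [hf.2.1, hg.2.1] with x hfx hgx hx
    rw [hfx hx, hgx hx, add_zero, zero_div]
  · exact (lintegral_abs_rpow_lt_top_iff hm).2 (integrable_abs_midpoint_rpow hp hf.1 hg.1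
      ((lintegral_abs_rpow_lt_top_iff hf.1).1 hf.2.2.1)
      ((lintegral_abs_rpow_lt_top_iff hg.1).1 hg.2.2.1))
  · exact (gagliardoE_midpoint_le hp hf.1).trans_lt (ENNReal.mul_lt_top ENNReal.ofReal_lt_top
      (ENNReal.add_lt_top.2 ⟨hf.2.2.2.1, hg.2.2.2.1⟩))
  · exact (lintegral_abs_rpow_lt_top_iff hm).2 (integrable_abs_midpoint_rpow (by linarith) hf.1 hg.1
      hf.integrable_abs_rpow hg.integrable_abs_rpow)

/-- The local integrand of the functional, shifted by a multiple of `|a| ^ (q + 1)` which makes it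
nonnegative. -/
def shiftedIntegrand (q a t : ℝ) : ℝ :=
  (1 / (q + 1)) * |t| ^ (q + 1) - |a| ^ (q - 1) * a * t + (2 * (q + 1)) ^ (1 / q) * |a| ^ (q + 1)

theorem abs_rpow_sub_one_mul_self {q : ℝ} (hq : 0 < q) (a : ℝ) :
    |(|a| ^ (q - 1) * a)| = |a| ^ q := by
  rcases eq_or_ne a 0 with rfl | ha
  · simp [zero_rpow hq.ne']
  · rw [abs_mul, abs_of_nonneg (rpow_nonneg (abs_nonneg a) _), rpow_sub_one (abs_ne_zero.2 ha),
      div_mul_cancel₀ _ (abs_ne_zero.2 ha)]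

theorem le_shiftedIntegrand {q : ℝ} (hq : 0 < q) (a t : ℝ) :
    1 / (2 * (q + 1)) * |t| ^ (q + 1) ≤ shiftedIntegrand q a t := by
  have h1 := rpow_mul_abs_le hq a t
  have h2 := le_abs_self (|a| ^ (q - 1) * a * t)
  rw [abs_mul, abs_rpow_sub_one_mul_self hq] at h2
  have h3 : 1 / (q + 1) = 2 * (1 / (2 * (q + 1))) := by field_simp
  rw [shiftedIntegrand, h3]
  linarith

theorem shiftedIntegrand_nonneg {q : ℝ} (hq : 0 < q) (a t : ℝ) : 0 ≤ shiftedIntegrand q a t := by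
  have h : 0 ≤ 1 / (2 * (q + 1)) * |t| ^ (q + 1) := by positivity
  exact h.trans (le_shiftedIntegrand hq a t)

theorem measurable_shiftedIntegrand {α : Type*} [MeasurableSpace α] (q : ℝ) {v w : α → ℝ}
    (hv : Measurable v) (hw : Measurable w) :
    Measurable fun x => shiftedIntegrand q (v x) (w x) :=
  (((measurable_abs_rpow hw _).const_mul _).sub
    (((measurable_abs_rpow hv _).mul hv).mul hw)).add ((measurable_abs_rpow hv _).const_mul _)

theorem integrable_rpow_mul {α : Type*} [MeasurableSpace α] {μ : Measure α} {q : ℝ} (hq : 0 < q)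
    {v w : α → ℝ} (hv : Measurable v) (hw : Measurable w)
    (hvq : Integrable (fun x => |v x| ^ (q + 1)) μ)
    (hwq : Integrable (fun x => |w x| ^ (q + 1)) μ) :
    Integrable (fun x => |v x| ^ (q - 1) * v x * w x) μ := by
  refine ((hwq.const_mul (1 / (2 * (q + 1)))).add
    (hvq.const_mul ((2 * (q + 1)) ^ (1 / q)))).mono'
    (((measurable_abs_rpow hv _).mul hv).mul hw).aestronglyMeasurable (ae_of_all _ fun x => ?_)
  rw [norm_eq_abs, abs_mul, abs_rpow_sub_one_mul_self hq]
  exact rpow_mul_abs_le hq (v x) (w x)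

theorem MemX.integrable_shiftedIntegrand {n : ℕ} {Ω : Set (Rn n)} {s p q : ℝ} (hq : 0 < q)
    {v w : Rn n → ℝ} (hv : MemX n Ω s p q v) (hw : MemX n Ω s p q w) :
    Integrable (fun x => shiftedIntegrand q (v x) (w x)) (volume.restrict Ω) :=
  ((hw.integrable_abs_rpow.const_mul _).sub (integrable_rpow_mul hq hv.1 hw.1
    hv.integrable_abs_rpow hw.integrable_abs_rpow)).add (hv.integrable_abs_rpow.const_mul _)

/-- The functional, up to an additive constant, as a sum of two nonnegative terms. -/
theorem Ffun_eq {n : ℕ} {Ω : Set (Rn n)} {s p q : ℝ} (hq : 0 < q) (h : ℝ) {v w : Rn n → ℝ}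
    (hv : MemX n Ω s p q v) (hw : MemX n Ω s p q w) :
    Ffun n Ω s p q h v w = (1 / h) * (∫ x in Ω, shiftedIntegrand q (v x) (w x)) +
      (1 / (2 * p)) * (gagliardoE n s p w).toReal -
      (1 / h) * ((2 * (q + 1)) ^ (1 / q) * ∫ x in Ω, |v x| ^ (q + 1)) := by
  have hsub : Integrable (fun x => (1 / (q + 1)) * |w x| ^ (q + 1) - |v x| ^ (q - 1) * v x * w x)
      (volume.restrict Ω) :=
    (hw.integrable_abs_rpow.const_mul _).sub (integrable_rpow_mul hq hv.1 hw.1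
      hv.integrable_abs_rpow hw.integrable_abs_rpow)
  simp only [shiftedIntegrand]
  rw [integral_add hsub (hv.integrable_abs_rpow.const_mul _), integral_const_mul, Ffun]
  ring

/-- The convexity deficit of the functional controls that of its leading local term. -/
theorem deficit_le_Ffun {n : ℕ} {Ω : Set (Rn n)} {s p q : ℝ} (hp : 1 < p) (hq : 0 < q) (h : ℝ)
    {v f g : Rn n → ℝ} (hv : MemX n Ω s p q v) (hf : MemX n Ω s p q f)
    (hg : MemX n Ω s p q g) :
    (1 / h) * (1 / (q + 1) * ∫ x in Ω, ((|f x| ^ (q + 1) + |g x| ^ (q + 1)) / 2 -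
      |(f x + g x) / 2| ^ (q + 1))) ≤
    (Ffun n Ω s p q h v f + Ffun n Ω s p q h v g) / 2 -
      Ffun n Ω s p q h v (fun x => (f x + g x) / 2) := by
  have hm := hf.midpoint hp.le hq hg
  have hEf := hf.2.2.2.1
  have hEg := hg.2.2.2.1
  have hE : (gagliardoE n s p fun x => (f x + g x) / 2).toReal ≤
      ((gagliardoE n s p f).toReal + (gagliardoE n s p g).toReal) / 2 := by
    have := ENNReal.toReal_mono (ENNReal.mul_lt_top ENNReal.ofReal_lt_top
      (ENNReal.add_lt_top.2 ⟨hEf, hEg⟩)).ne (gagliardoE_midpoint_le hp.le hf.1)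
    rw [ENNReal.toReal_mul, ENNReal.toReal_add hEf.ne hEg.ne,
      ENNReal.toReal_ofReal (by norm_num)] at this
    linarith
  have hsum : Integrable (fun x => shiftedIntegrand q (v x) (f x) + shiftedIntegrand q (v x) (g x))
      (volume.restrict Ω) :=
    (hv.integrable_shiftedIntegrand hq hf).add (hv.integrable_shiftedIntegrand hq hg)
  have hdef : 1 / (q + 1) * ∫ x in Ω, ((|f x| ^ (q + 1) + |g x| ^ (q + 1)) / 2 -
      |(f x + g x) / 2| ^ (q + 1)) =
      ((∫ x in Ω, shiftedIntegrand q (v x) (f x)) +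
        ∫ x in Ω, shiftedIntegrand q (v x) (g x)) / 2 -
      ∫ x in Ω, shiftedIntegrand q (v x) ((f x + g x) / 2) := by
    rw [← integral_add (hv.integrable_shiftedIntegrand hq hf)
      (hv.integrable_shiftedIntegrand hq hg), ← integral_div,
      ← integral_sub (hsum.div_const 2) (hv.integrable_shiftedIntegrand hq hm),
      ← integral_const_mul]
    refine integral_congr_ae (ae_of_all _ fun x => ?_)
    simp only [shiftedIntegrand]
    ring
  rw [hdef, Ffun_eq hq h hv hf, Ffun_eq hq h hv hg, Ffun_eq hq h hv hm]
  have hE' := mul_le_mul_of_nonneg_left hE (by positivity : 0 ≤ 1 / (2 * p))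
  linarith

/-- A minimizing sequence in `X` has a subsequence converging almost everywhere. -/
theorem exists_seq_tendsto_ae_of_minimizing {n : ℕ} {Ω : Set (Rn n)} (hΩ : MeasurableSet Ω)
    (hbdd : Bornology.IsBounded Ω) {s p q : ℝ} (hp : 1 < p) (hq : 0 < q) {h : ℝ} (hh : 0 < h)
    {v : Rn n → ℝ} (hv : MemX n Ω s p q v) {m : ℝ}
    (hm : ∀ w, MemX n Ω s p q w → m ≤ Ffun n Ω s p q h v w) {w : ℕ → Rn n → ℝ}
    (hw : ∀ k, MemX n Ω s p q (w k))
    (hlim : Tendsto (fun k => Ffun n Ω s p q h v (w k)) atTop (𝓝 m)) :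
    ∃ u : Rn n → ℝ, Measurable u ∧ (∀ x ∉ Ω, u x = 0) ∧ ∃ ns : ℕ → ℕ, StrictMono ns ∧
      ∀ᵐ x, Tendsto (fun i => w (ns i) x) atTop (𝓝 (u x)) := by
  have : IsFiniteMeasure (volume.restrict Ω) := ⟨by simpa using hbdd.measure_lt_top⟩
  have hq1 : 0 < q + 1 := by linarith
  obtain ⟨B, hB⟩ := hlim.bddAbove_range
  have hη : Tendsto (fun k => h * (q + 1) / 2 * (Ffun n Ω s p q h v (w k) - m)) atTop (𝓝 0) := by
    simpa using (hlim.sub_const m).const_mul (h * (q + 1) / 2)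
  have hbound : ∀ k, ∫ x in Ω, |w k x| ^ (q + 1) ≤ 2 * (q + 1) * (h * (B + (1 / h) *
      ((2 * (q + 1)) ^ (1 / q) * ∫ x in Ω, |v x| ^ (q + 1)))) := by
    intro k
    have h1 := hB (mem_range_self k)
    simp only [Ffun_eq hq h hv (hw k)] at h1
    have h2 := integral_mono ((hw k).integrable_abs_rpow.const_mul (1 / (2 * (q + 1))))
      (hv.integrable_shiftedIntegrand hq (hw k)) fun x => le_shiftedIntegrand hq (v x) (w k x)
    rw [integral_const_mul] at h2
    have h3 : 0 ≤ 1 / (2 * p) * (gagliardoE n s p (w k)).toReal := by positivity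
    have h4 : 1 / h * (∫ x in Ω, shiftedIntegrand q (v x) (w k x)) ≤
        B + (1 / h) * ((2 * (q + 1)) ^ (1 / q) * ∫ x in Ω, |v x| ^ (q + 1)) := by linarith
    rw [one_div_mul_eq_div, div_le_iff₀' hh] at h4
    have h5 := h2.trans h4
    rwa [one_div_mul_eq_div, div_le_iff₀' (by positivity)] at h5
  have hdef : ∀ j k, ∫ x in Ω, ((|w j x| ^ (q + 1) + |w k x| ^ (q + 1)) / 2 -
      |(w j x + w k x) / 2| ^ (q + 1)) ≤ h * (q + 1) / 2 * (Ffun n Ω s p q h v (w j) - m) +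
        h * (q + 1) / 2 * (Ffun n Ω s p q h v (w k) - m) := by
    intro j k
    have h1 := deficit_le_Ffun hp hq h hv (hw j) (hw k)
    have h2 := hm _ ((hw j).midpoint hp.le hq (hw k))
    have h3 := h1.trans (sub_le_sub_left h2 _)
    rw [one_div_mul_eq_div, div_le_iff₀' hh, one_div_mul_eq_div, div_le_iff₀' hq1] at h3
    linarith
  obtain ⟨u, hu, ns, hns, hae⟩ := exists_seq_tendsto_ae_of_deficit (by linarith : 1 < q + 1)
    (fun k => (hw k).1) (fun k => (hw k).integrable_abs_rpow) hbound hη hdef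
  refine ⟨Ω.indicator u, hu.indicator hΩ, fun x hx => indicator_of_notMem hx u, ns, hns, ?_⟩
  filter_upwards [(ae_restrict_iff' hΩ).1 hae, ae_all_iff.2 fun k => (hw k).2.1] with x hx h0
  by_cases hxΩ : x ∈ Ω
  · simpa [hxΩ] using hx hxΩ
  · simp [hxΩ, h0 _ hxΩ]

/-- Appendix A: the functional `F` is bounded below on `X` and attains its infimum. -/
theorem existence_of_minimizer
    (n : ℕ) (hn : 1 ≤ n) (Ω : Set (Rn n)) (hΩ : IsBoundedDomain Ω)
    (s p q : ℝ) (hs : s ∈ Ioo (0 : ℝ) 1) (hp : 1 < p) (hq : 0 < q)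
    (h : ℝ) (hh : 0 < h) (v : Rn n → ℝ) (hv : MemX n Ω s p q v) :
    BddBelow ((fun w => Ffun n Ω s p q h v w) '' {w | MemX n Ω s p q w}) ∧
      ∃ u : Rn n → ℝ, MemX n Ω s p q u ∧
        ∀ w : Rn n → ℝ, MemX n Ω s p q w → Ffun n Ω s p q h v u ≤ Ffun n Ω s p q h v w := by
  have hp0 : 0 < p := by linarith
  have hΩm : MeasurableSet Ω := hΩ.1.measurableSet
  set c := (1 / h) * ((2 * (q + 1)) ^ (1 / q) * ∫ x in Ω, |v x| ^ (q + 1)) with hc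
  have hA0 : ∀ w : Rn n → ℝ, 0 ≤ ∫ x in Ω, shiftedIntegrand q (v x) (w x) := fun w =>
    integral_nonneg fun x => shiftedIntegrand_nonneg hq _ _
  have hbdd : BddBelow ((fun w => Ffun n Ω s p q h v w) '' {w | MemX n Ω s p q w}) := by
    refine ⟨-c, ?_⟩
    rintro _ ⟨w, hw, rfl⟩
    have h1 : 0 ≤ 1 / h * ∫ x in Ω, shiftedIntegrand q (v x) (w x) :=
      mul_nonneg (by positivity) (hA0 w)
    have h2 : 0 ≤ 1 / (2 * p) * (gagliardoE n s p w).toReal := by positivity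
    simp only [Ffun_eq hq h hv hw]
    linarith
  refine ⟨hbdd, ?_⟩
  obtain ⟨F, -, hFlim, hF⟩ := exists_seq_tendsto_sInf
    (⟨_, mem_image_of_mem _ (memX_zero hp0 hq)⟩ :
      ((fun w => Ffun n Ω s p q h v w) '' {w | MemX n Ω s p q w}).Nonempty) hbdd
  set m := sInf ((fun w => Ffun n Ω s p q h v w) '' {w | MemX n Ω s p q w})
  have hm : ∀ w, MemX n Ω s p q w → m ≤ Ffun n Ω s p q h v w := fun w hw =>
    csInf_le hbdd (mem_image_of_mem _ hw)
  choose w hw hwF using hF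
  obtain rfl : (fun k => Ffun n Ω s p q h v (w k)) = F := funext hwF
  obtain ⟨u, hu, hu0, ns, hns, hae⟩ :=
    exists_seq_tendsto_ae_of_minimizing hΩm hΩ.2.2 hp hq hh hv hm hw hFlim
  obtain ⟨B, hB⟩ := hFlim.bddAbove_range
  have hEbound : ∀ i, (gagliardoE n s p (w (ns i))).toReal ∈ Icc 0 (2 * p * (B + c)) := by
    intro i
    refine ⟨ENNReal.toReal_nonneg, ?_⟩
    have h1 := hB (mem_range_self (ns i))
    simp only [Ffun_eq hq h hv (hw _)] at h1
    have h2 : 0 ≤ 1 / h * ∫ x in Ω, shiftedIntegrand q (v x) (w (ns i) x) :=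
      mul_nonneg (by positivity) (hA0 _)
    have h3 : 1 / (2 * p) * (gagliardoE n s p (w (ns i))).toReal ≤ B + c := by linarith
    rwa [one_div_mul_eq_div, div_le_iff₀' (by positivity)] at h3
  obtain ⟨e, he, ms, hms, hElim⟩ := isCompact_Icc.tendsto_subseq hEbound
  have hFsub := hFlim.comp (hns.tendsto_atTop.comp hms.tendsto_atTop)
  have hae' : ∀ᵐ x, Tendsto (fun i => w (ns (ms i)) x) atTop (𝓝 (u x)) :=
    hae.mono fun x hx => hx.comp hms.tendsto_atTop
  have hAlim : Tendsto (fun i => ∫ x in Ω, shiftedIntegrand q (v x) (w (ns (ms i)) x)) atTop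
      (𝓝 (h * (m + c - 1 / (2 * p) * e))) := by
    refine (((hFsub.add_const c).sub (hElim.const_mul (1 / (2 * p)))).const_mul h).congr
      fun i => ?_
    simp only [Function.comp_apply, Ffun_eq hq h hv (hw _), ← hc]
    field_simp
    ring
  have hEu : gagliardoE n s p u ≤ ENNReal.ofReal e := by
    refine gagliardoE_le_of_tendsto_ae hp0.le (fun i => (hw (ns (ms i))).1) hae'
      ((ENNReal.tendsto_ofReal hElim).congr fun i => ?_)
    exact ENNReal.ofReal_toReal (hw _).2.2.2.1.ne
  have hAu : ∫⁻ x in Ω, ENNReal.ofReal (shiftedIntegrand q (v x) (u x)) ≤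
      ENNReal.ofReal (h * (m + c - 1 / (2 * p) * e)) := by
    refine lintegral_le_of_tendsto_ae
      (fun i => (measurable_shiftedIntegrand q hv.1 (hw (ns (ms i))).1).ennreal_ofReal)
      (ae_restrict_of_ae (hae'.mono fun x hx => ENNReal.tendsto_ofReal ?_))
      ((ENNReal.tendsto_ofReal hAlim).congr fun i => ?_)
    · exact (((hx.abs.rpow_const (Or.inr (by linarith))).const_mul _).sub
        (hx.const_mul _)).add_const _
    · exact ofReal_integral_eq_lintegral_ofReal (hv.integrable_shiftedIntegrand hq (hw _))
        (ae_of_all _ fun x => shiftedIntegrand_nonneg hq _ _)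
  have huX : MemX n Ω s p q u := by
    have hE := hEu.trans_lt ENNReal.ofReal_lt_top
    refine ⟨hu, ae_of_all _ hu0, lintegral_rpow_lt_top_of_gagliardoE hn hΩm hΩ.2.2 hs.1 hp0 hu
      (ae_of_all _ hu0) hE, hE, ?_⟩
    refine lt_of_le_of_lt (lintegral_mono fun x => ?_)
      ((lintegral_const_mul' (ENNReal.ofReal (2 * (q + 1))) _ ENNReal.ofReal_ne_top).trans_lt
        (ENNReal.mul_lt_top ENNReal.ofReal_lt_top (hAu.trans_lt ENNReal.ofReal_lt_top)))
    have h1 := le_shiftedIntegrand hq (v x) (u x)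
    rw [one_div_mul_eq_div, div_le_iff₀' (by positivity)] at h1
    rw [← ENNReal.ofReal_mul (by positivity)]
    exact ENNReal.ofReal_le_ofReal h1
  have hAlim0 : 0 ≤ h * (m + c - 1 / (2 * p) * e) := ge_of_tendsto' hAlim fun i => hA0 _
  rw [← ofReal_integral_eq_lintegral_ofReal (hv.integrable_shiftedIntegrand hq huX)
    (ae_of_all _ fun x => shiftedIntegrand_nonneg hq _ _), ENNReal.ofReal_le_ofReal_iff hAlim0,
    ← div_le_iff₀' hh, ← one_div_mul_eq_div] at hAu
  have hEu' : 1 / (2 * p) * (gagliardoE n s p u).toReal ≤ 1 / (2 * p) * e :=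
    mul_le_mul_of_nonneg_left (ENNReal.toReal_le_of_le_ofReal he.1 hEu) (by positivity)
  refine ⟨u, huX, fun w' hw' => le_trans ?_ (hm w' hw')⟩
  rw [Ffun_eq hq h hv huX, ← hc]
  linarith
end
end

section
/- Energy estimates for the difference scheme, first set (Lemma 3.3, estimates (3.4)–(3.5)). Let n ≥ 1, let Ω ⊂ ℝⁿ be a bounded domain, s ∈ (0,1), p > 1, q > 0, h > 0, N ∈ ℕ, and assume the scheme hypothesis: u₀ ∈ X and u₁,…,u_N ∈ X are such that for each m = 1,…,N, u_m solves the discrete equation with datum u_{m−1} and step h. Then: (a) ∫_Ω |u_k|^{q+1} dx ≤ ∫_Ω |u₀|^{q+1} dx for every k = 1,…,N; and (b) Σ_{m=1}^{N} h [u_m]_{W^{s,p}(ℝⁿ)}^p ≤ (2q/(q+1)) ∫_Ω |u₀|^{q+1} dx. -/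
open MeasureTheory ENNReal Real Filter Set

noncomputable section

/-- `u` solves the discrete (Rothe-type) nonlocal equation with datum `v` and time step `h`:
for every test function `ξ ∈ X`,
`(1/h)∫_Ω (|u|^{q−1}u − |v|^{q−1}v) ξ dx
  + (1/2)∬ |u(x)−u(y)|^{p−2}(u(x)−u(y))(ξ(x)−ξ(y))/|x−y|^{n+sp} dx dy = 0`. -/
def SolvesDiscrete (n : ℕ) (Ω : Set (Rn n)) (s p q h : ℝ) (u v : Rn n → ℝ) : Prop :=
  ∀ ξ : Rn n → ℝ, MemX n Ω s p q ξ →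
    (1 / h) * (∫ x in Ω, (|u x| ^ (q - 1) * u x - |v x| ^ (q - 1) * v x) * ξ x) +
      (1 / 2) * (∫ x : Rn n, ∫ y : Rn n,
        (|u x - u y| ^ (p - 2) * (u x - u y)) * (ξ x - ξ y) / dist x y ^ ((n : ℝ) + s * p)) = 0

theorem abs_rpow_sub_two_mul_self_mul_self {r : ℝ} (hr : r ≠ 0) (a : ℝ) :
    |a| ^ (r - 2) * a * a = |a| ^ r := by
  rcases eq_or_ne a 0 with rfl | ha
  · simp [Real.zero_rpow hr]
  · have hpos : 0 < |a| := abs_pos.mpr ha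
    rw [mul_assoc, ← abs_mul_abs_self a, ← mul_assoc]
    rw [show r = (r - 2) + 1 + 1 by ring, Real.rpow_add_one hpos.ne', Real.rpow_add_one hpos.ne']
    ring_nf

theorem abs_abs_rpow_sub_one_mul_self {q : ℝ} (hq : q ≠ 0) (b : ℝ) :
    |(|b| ^ (q - 1) * b)| = |b| ^ q := by
  rcases eq_or_ne b 0 with rfl | hb
  · simp [Real.zero_rpow hq]
  · have hpos : 0 < |b| := abs_pos.mpr hb
    rw [abs_mul, abs_of_nonneg (Real.rpow_nonneg hpos.le _), ← Real.rpow_add_one hpos.ne',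
      sub_add_cancel]

/-- Young's inequality with exponents `(q + 1) / q` and `q + 1`. -/
theorem abs_rpow_mul_abs_le {q : ℝ} (hq : 0 < q) (a b : ℝ) :
    |b| ^ q * |a| ≤ q / (q + 1) * |b| ^ (q + 1) + 1 / (q + 1) * |a| ^ (q + 1) := by
  have hconj : ((q + 1) / q).HolderConjugate (q + 1) := by
    rw [Real.holderConjugate_iff]
    constructor
    · rw [lt_div_iff₀ hq]; linarith
    · field_simp
  have hy := Real.young_inequality_of_nonneg (Real.rpow_nonneg (abs_nonneg b) q)
    (abs_nonneg a) hconj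
  rw [← Real.rpow_mul (abs_nonneg b), mul_div_cancel₀ _ hq.ne'] at hy
  calc _ ≤ _ := hy
    _ = _ := by field_simp

theorem rpow_increment_le {q : ℝ} (hq : 0 < q) (a b : ℝ) :
    q / (q + 1) * (|a| ^ (q + 1) - |b| ^ (q + 1)) ≤
      (|a| ^ (q - 1) * a - |b| ^ (q - 1) * b) * a := by
  have h1 := abs_rpow_sub_two_mul_self_mul_self (r := q + 1) (by positivity) a
  rw [show q + 1 - 2 = q - 1 by ring] at h1
  have h2 : |b| ^ (q - 1) * b * a ≤ |b| ^ q * |a| := by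
    rw [← abs_abs_rpow_sub_one_mul_self hq.ne', ← abs_mul]
    exact le_abs_self _
  have h3 := abs_rpow_mul_abs_le hq a b
  have h4 : q / (q + 1) * |a| ^ (q + 1) + 1 / (q + 1) * |a| ^ (q + 1) = |a| ^ (q + 1) := by
    field_simp
  rw [sub_mul, h1]
  linarith

/-- The weak form of the nonlocal operator, tested with the function itself, is the energy. -/
theorem integral_integral_eq_toReal_gagliardoE {n : ℕ} {s p : ℝ} (hp : p ≠ 0) {v : Rn n → ℝ}
    (hv : Measurable v) (hfin : gagliardoE n s p v < ⊤) :
    (∫ x : Rn n, ∫ y : Rn n,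
        (|v x - v y| ^ (p - 2) * (v x - v y)) * (v x - v y) / dist x y ^ ((n : ℝ) + s * p))
      = (gagliardoE n s p v).toReal := by
  have hmeas : Measurable fun z : Rn n × Rn n =>
      |v z.1 - v z.2| ^ p / dist z.1 z.2 ^ ((n : ℝ) + s * p) := by
    have h1 : Measurable fun z : Rn n × Rn n => v z.1 := hv.comp measurable_fst
    have h2 : Measurable fun z : Rn n × Rn n => v z.2 := hv.comp measurable_snd
    exact ((h1.sub h2).abs.pow_const p).div (measurable_dist.pow_const _)
  have hinner : Measurable fun x : Rn n =>
      ∫⁻ y : Rn n, ENNReal.ofReal (|v x - v y| ^ p / dist x y ^ ((n : ℝ) + s * p)) :=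
    hmeas.ennreal_ofReal.lintegral_prod_right'
  simp_rw [abs_rpow_sub_two_mul_self_mul_self hp]
  rw [gagliardoE, ← integral_toReal hinner.aemeasurable (ae_lt_top hinner hfin.ne)]
  congr 1 with x
  refine integral_eq_lintegral_of_nonneg_ae (ae_of_all _ fun y => by positivity) ?_
  exact (hmeas.comp measurable_prodMk_left).aestronglyMeasurable

theorem MemX.integrableOn_abs_rpow {n : ℕ} {Ω : Set (Rn n)} {s p q : ℝ} {v : Rn n → ℝ}
    (hv : MemX n Ω s p q v) : IntegrableOn (fun x => |v x| ^ (q + 1)) Ω := by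
  refine ⟨(hv.1.abs.pow_const _).aestronglyMeasurable, ?_⟩
  rw [hasFiniteIntegral_iff_ofReal (ae_of_all _ fun x => by positivity)]
  exact hv.2.2.2.2

theorem MemX.setIntegral_abs_rpow {n : ℕ} {Ω : Set (Rn n)} {s p q : ℝ} {v : Rn n → ℝ}
    (hv : MemX n Ω s p q v) :
    ∫ x in Ω, |v x| ^ (q + 1) = (∫⁻ x in Ω, ENNReal.ofReal (|v x| ^ (q + 1))).toReal :=
  integral_eq_lintegral_of_nonneg_ae (ae_of_all _ fun x => by positivity)
    (hv.1.abs.pow_const _).aestronglyMeasurable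

theorem MemX.integrableOn_rpow_increment_mul {n : ℕ} {Ω : Set (Rn n)} {s p q : ℝ} (hq : 0 < q)
    {u v : Rn n → ℝ} (hu : MemX n Ω s p q u) (hv : MemX n Ω s p q v) :
    IntegrableOn (fun x => (|u x| ^ (q - 1) * u x - |v x| ^ (q - 1) * v x) * u x) Ω := by
  have hmu := hu.1
  have hmv := hv.1
  have hself : ∀ a : ℝ, |a| ^ (q - 1) * a * a = |a| ^ (q + 1) := fun a => by
    rw [← abs_rpow_sub_two_mul_self_mul_self (r := q + 1) (by positivity) a,
      show q + 1 - 2 = q - 1 by ring]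
  have hcross : IntegrableOn (fun x => |v x| ^ (q - 1) * v x * u x) Ω := by
    refine Integrable.mono' ((hv.integrableOn_abs_rpow.const_mul (q / (q + 1))).add
      (hu.integrableOn_abs_rpow.const_mul (1 / (q + 1)))) ?_ (ae_of_all _ fun x => ?_)
    · exact (((hmv.abs.pow_const _).mul hmv).mul hmu).aestronglyMeasurable
    · rw [Real.norm_eq_abs, abs_mul, abs_abs_rpow_sub_one_mul_self hq.ne']
      exact abs_rpow_mul_abs_le hq _ _
  simp_rw [sub_mul, hself]
  exact hu.integrableOn_abs_rpow.sub hcross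

/-- The energy inequality for a single step of the scheme. -/
theorem SolvesDiscrete.energy_step {n : ℕ} {Ω : Set (Rn n)} {s p q h : ℝ} (hp : p ≠ 0)
    (hq : 0 < q) (hh : 0 < h) {u v : Rn n → ℝ} (hu : MemX n Ω s p q u) (hv : MemX n Ω s p q v)
    (huv : SolvesDiscrete n Ω s p q h u v) :
    h * (gagliardoE n s p u).toReal ≤
      2 * q / (q + 1) * ((∫⁻ x in Ω, ENNReal.ofReal (|v x| ^ (q + 1))).toReal
        - (∫⁻ x in Ω, ENNReal.ofReal (|u x| ^ (q + 1))).toReal) := by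
  have heq := huv u hu
  rw [integral_integral_eq_toReal_gagliardoE hp hu.1 hu.2.2.2.1] at heq
  have hmono : ∫ x in Ω, q / (q + 1) * (|u x| ^ (q + 1) - |v x| ^ (q + 1)) ≤
      ∫ x in Ω, (|u x| ^ (q - 1) * u x - |v x| ^ (q - 1) * v x) * u x :=
    integral_mono ((hu.integrableOn_abs_rpow.sub hv.integrableOn_abs_rpow).const_mul _)
      (hu.integrableOn_rpow_increment_mul hq hv) fun x => rpow_increment_le hq _ _
  rw [integral_const_mul, integral_sub hu.integrableOn_abs_rpow hv.integrableOn_abs_rpow,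
    hu.setIntegral_abs_rpow, hv.setIntegral_abs_rpow] at hmono
  generalize (∫ x in Ω, (|u x| ^ (q - 1) * u x - |v x| ^ (q - 1) * v x) * u x) = I at heq hmono
  rw [mul_div_assoc]
  field_simp at heq
  linarith

theorem gagliardoSemi_rpow {n : ℕ} {s p : ℝ} (hp : p ≠ 0) (v : Rn n → ℝ) :
    gagliardoSemi n s p v ^ p = (gagliardoE n s p v).toReal := by
  rw [gagliardoSemi, one_div, Real.rpow_inv_rpow ENNReal.toReal_nonneg hp]

/-- Lemma 3.3, estimates (3.4)–(3.5): first set of energy estimates for the scheme. -/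
theorem energy_estimates_first_set
    (n : ℕ) (hn : 1 ≤ n) (Ω : Set (Rn n)) (hΩ : IsBoundedDomain Ω)
    (s p q : ℝ) (hs : s ∈ Ioo (0 : ℝ) 1) (hp : 1 < p) (hq : 0 < q)
    (h : ℝ) (hh : 0 < h) (N : ℕ) (u : ℕ → Rn n → ℝ)
    (hX : ∀ m, m ≤ N → MemX n Ω s p q (u m))
    (hscheme : ∀ m, 1 ≤ m → m ≤ N → SolvesDiscrete n Ω s p q h (u m) (u (m - 1))) :
    (∀ k, 1 ≤ k → k ≤ N →
      (∫⁻ x in Ω, ENNReal.ofReal (|u k x| ^ (q + 1)))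
        ≤ ∫⁻ x in Ω, ENNReal.ofReal (|u 0 x| ^ (q + 1))) ∧
    (∑ m ∈ Finset.Icc 1 N, h * gagliardoSemi n s p (u m) ^ p
        ≤ (2 * q / (q + 1)) * (∫⁻ x in Ω, ENNReal.ofReal (|u 0 x| ^ (q + 1))).toReal) := by
  have hp0 : p ≠ 0 := by positivity
  set A : ℕ → ℝ := fun m => (∫⁻ x in Ω, ENNReal.ofReal (|u m x| ^ (q + 1))).toReal with hA
  have hstep : ∀ m, m + 1 ≤ N →
      h * gagliardoSemi n s p (u (m + 1)) ^ p ≤ 2 * q / (q + 1) * (A m - A (m + 1)) :=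
    fun m hm => by
      rw [gagliardoSemi_rpow hp0]
      exact (hscheme (m + 1) (by omega) hm).energy_step hp0 hq hh (hX _ hm) (hX _ (by omega))
  have hsum : ∀ k, k ≤ N → ∑ m ∈ Finset.Icc 1 k, h * gagliardoSemi n s p (u m) ^ p ≤
      2 * q / (q + 1) * (A 0 - A k) := by
    intro k
    induction k with
    | zero => simp
    | succ k ih =>
      intro hk
      rw [Finset.sum_Icc_succ_top (by omega)]
      linarith [ih (by omega), hstep k hk]
  have hterm : ∀ m, 0 ≤ h * gagliardoSemi n s p (u m) ^ p := fun m => by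
    rw [gagliardoSemi_rpow hp0]
    positivity
  have hc : 0 < 2 * q / (q + 1) := by positivity
  refine ⟨fun k _ hk => ?_, ?_⟩
  · have hdiff : 0 ≤ A 0 - A k := nonneg_of_mul_nonneg_right
      ((Finset.sum_nonneg fun m _ => hterm m).trans (hsum k hk)) hc
    exact (ENNReal.toReal_le_toReal (hX k hk).2.2.2.2.ne (hX 0 (by omega)).2.2.2.2.ne).mp
      (by simpa [hA] using hdiff)
  · refine (hsum N le_rfl).trans (mul_le_mul_of_nonneg_left ?_ hc.le)
    exact sub_le_self _ ENNReal.toReal_nonneg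
end
end
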